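/- arXiv:2007.07946 — 2 statements merged into one kernel-verified Lean document; each statement's English description precedes it below -/
import Mathlib

section
/- Assume the growth conditions (i) and (ii) on α, and suppose additionally sup_{t≥0} |α′(t)/α(t)| < ∞ so that Lemma-type bounds on K apply. Then there exist constants 0 < c ≤ C < ∞ and t₀ > 0 such that for all t ≥ t₀, c/α(t) ≤ K(t,t) = ∫₀ᵗ exp(−2(A(t) − A(s))) ds ≤ C/α(t). -/
open MeasureTheory ProbabilityTheory Real Filter Set

/-- `Aint α t = ∫₀ᵗ α(u) du`. -/
noncomputable def Aint (α : ℝ → ℝ) (t : ℝ) : ℝ := ∫ u in (0:ℝ)..t, α u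

/-- `alphaStar α t = sup_{0 ≤ r ≤ t} α(r)`. -/
noncomputable def alphaStar (α : ℝ → ℝ) (t : ℝ) : ℝ := sSup (α '' Set.Icc 0 t)

/-- Covariance kernel of the infinite time horizon Brownian bridge. -/
noncomputable def Kker (α : ℝ → ℝ) (s t : ℝ) : ℝ :=
  Real.exp (-(Aint α s) - Aint α t) * ∫ u in (0:ℝ)..(min s t), Real.exp (2 * Aint α u)

/-- `X` is an infinite time horizon Brownian bridge associated with coefficient `α`:
every finite real linear combination of the `X_{t_i}` (for `t_i ≥ 0`) is a centered
Gaussian random variable, and the covariance is given by the kernel `Kker α`. -/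
def IsBridge {Ω : Type*} [MeasurableSpace Ω] (P : Measure Ω) (α : ℝ → ℝ)
    (X : ℝ → Ω → ℝ) : Prop :=
  (∀ (n : ℕ) (c t : Fin n → ℝ), (∀ i, 0 ≤ t i) →
    ∃ v : NNReal, P.map (fun ω => ∑ i, c i * X (t i) ω) = gaussianReal 0 v) ∧
  (∀ s t : ℝ, 0 ≤ s → 0 ≤ t → ∫ ω, X s ω * X t ω ∂P = Kker α s t)

/-- Growth conditions (i) and (ii) on `α`, with parameters `γ ∈ [0,1/2]`, `β > 0`. -/
def GrowthCond (α : ℝ → ℝ) (γ β : ℝ) : Prop :=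
  ContDiffOn ℝ 1 α (Set.Ici 0) ∧ γ ∈ Set.Icc (0:ℝ) (1/2) ∧ 0 < β ∧
    (∃ C > (0:ℝ), ∀ t > (0:ℝ), (alphaStar α (t+1)) ^ (2*γ) / α t ≤ C * t ^ (-β)) ∧
    (∃ C : ℝ, ∀ t ≥ (0:ℝ), |deriv α t / α t| ≤ C)

/-- The approximating local time `L^x_{t,ε} = ∫₀ᵗ (2πε)^{-1/2} exp(-(X_r - x)²/(2ε)) dr`. -/
noncomputable def locApprox {Ω : Type*} (X : ℝ → Ω → ℝ) (x ε t : ℝ) (ω : Ω) : ℝ :=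
  ∫ r in (0:ℝ)..t, (Real.sqrt (2 * Real.pi * ε))⁻¹ * Real.exp (-(X r ω - x)^2 / (2*ε))

theorem ContinuousOn.continuousOn_primitive_Ici {f : ℝ → ℝ} {a : ℝ}
    (hf : ContinuousOn f (Set.Ici a)) :
    ContinuousOn (fun t => ∫ u in a..t, f u) (Set.Ici a) := by
  have hg : Continuous fun u => f (max a u) :=
    hf.comp_continuous (by fun_prop) fun u => le_max_left a u
  refine (intervalIntegral.continuous_primitive (μ := volume)
    (fun _ _ => hg.intervalIntegrable _ _) a).continuousOn.congr fun t ht => ?_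
  refine intervalIntegral.integral_congr fun u hu => ?_
  rw [Set.uIcc_of_le ht] at hu
  simp [max_eq_right hu.1]

theorem ContinuousOn.hasDerivAt_primitive_of_lt {f : ℝ → ℝ} {a t : ℝ}
    (hf : ContinuousOn f (Set.Ici a)) (ht : a < t) :
    HasDerivAt (fun t => ∫ u in a..t, f u) (f t) t := by
  refine intervalIntegral.integral_hasDerivAt_right
    ((hf.mono ?_).intervalIntegrable) ?_ (hf.continuousAt (Ici_mem_nhds ht))
  · rw [Set.uIcc_of_le ht.le]
    exact Set.Icc_subset_Ici_self
  · exact (hf.mono Set.Ioi_subset_Ici_self).stronglyMeasurableAtFilter isOpen_Ioi t ht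

theorem GrowthCond.tendsto_atTop {α : ℝ → ℝ} {γ β : ℝ} (h : GrowthCond α γ β)
    (hα_pos : ∀ t ≥ (0:ℝ), 0 < α t) (hα_cont : ContinuousOn α (Set.Ici 0)) :
    Tendsto α atTop atTop := by
  obtain ⟨-, hγ, hβ, ⟨C, hC, hbound⟩, -⟩ := h
  have h0 := hα_pos 0 le_rfl
  have hpow : 0 < α 0 ^ (2 * γ) := Real.rpow_pos_of_pos h0 _
  refine tendsto_atTop_mono' _ ?_
    ((tendsto_rpow_atTop hβ).const_mul_atTop (div_pos hpow hC))
  filter_upwards [eventually_gt_atTop (0:ℝ)] with t ht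
  have hαt := hα_pos t ht.le
  have hstar : α 0 ≤ alphaStar α (t + 1) :=
    le_csSup (isCompact_Icc.bddAbove_image (hα_cont.mono Set.Icc_subset_Ici_self))
      ⟨0, ⟨le_rfl, by linarith⟩, rfl⟩
  have hle : α 0 ^ (2 * γ) / α t ≤ C * t ^ (-β) := by
    refine le_trans ?_ (hbound t ht)
    gcongr
    linarith [hγ.1]
  have htβ : 0 < t ^ β := Real.rpow_pos_of_pos ht _
  rw [Real.rpow_neg ht.le, ← div_eq_mul_inv, div_le_div_iff₀ hαt htβ] at hle
  rw [div_mul_eq_mul_div, div_le_iff₀ hC]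
  linarith

theorem Kker_self (α : ℝ → ℝ) {t : ℝ} :
    Kker α t t = Real.exp (-(2 * Aint α t)) * ∫ u in (0:ℝ)..t, Real.exp (2 * Aint α u) := by
  rw [Kker, min_self]
  congr 2
  ring

theorem Kker_self_eq_integral (α : ℝ → ℝ) (t : ℝ) :
    Kker α t t = ∫ s in (0:ℝ)..t, Real.exp (-(2 * (Aint α t - Aint α s))) := by
  rw [Kker_self, ← intervalIntegral.integral_const_mul]
  refine intervalIntegral.integral_congr fun s _ => ?_
  simp only [← Real.exp_add]
  congr 1
  ring

theorem stmt_2 (α : ℝ → ℝ)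
    (hα_pos : ∀ t ≥ (0:ℝ), 0 < α t)
    (hα_cont : ContinuousOn α (Set.Ici 0))
    (hgrowth : ∃ γ β : ℝ, GrowthCond α γ β) :
    ∃ c C t₀ : ℝ, 0 < c ∧ c ≤ C ∧ 0 < t₀ ∧ ∀ t ≥ t₀,
      Kker α t t = (∫ s in (0:ℝ)..t, Real.exp (-(2 * (Aint α t - Aint α s)))) ∧
      c / α t ≤ Kker α t t ∧ Kker α t t ≤ C / α t := by
  obtain ⟨γ, β, h⟩ := hgrowth
  have htop := h.tendsto_atTop hα_pos hα_cont
  obtain ⟨hC1, -, -, -, L, hL⟩ := h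
  obtain ⟨t₀, ht₀, hlarge⟩ : ∃ t₀ > (0:ℝ), ∀ t ≥ t₀, L ≤ α t := by
    obtain ⟨T, hT⟩ := eventually_atTop.1 (htop.eventually_ge_atTop L)
    exact ⟨max T 1, by positivity, fun t ht => hT t (le_of_max_le_left ht)⟩
  set F : ℝ → ℝ := fun t => ∫ u in (0:ℝ)..t, Real.exp (2 * Aint α u) with hF
  set G : ℝ → ℝ := fun t => Real.exp (2 * Aint α t) / α t with hG
  have hAcont : ContinuousOn (Aint α) (Set.Ici 0) := hα_cont.continuousOn_primitive_Ici
  have hEcont : ContinuousOn (fun u => Real.exp (2 * Aint α u)) (Set.Ici 0) := by fun_prop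
  have hFderiv : ∀ t > 0, HasDerivAt F (Real.exp (2 * Aint α t)) t := fun t ht =>
    hEcont.hasDerivAt_primitive_of_lt ht
  have hGderiv : ∀ t > 0,
      HasDerivAt G (Real.exp (2 * Aint α t) * (2 - deriv α t / α t / α t)) t := by
    intro t ht
    have hne := (hα_pos t ht.le).ne'
    have hα : HasDerivAt α (deriv α t) t :=
      ((hC1.contDiffAt (Ici_mem_nhds ht)).differentiableAt one_ne_zero).hasDerivAt
    have hA : HasDerivAt (Aint α) (α t) t := hα_cont.hasDerivAt_primitive_of_lt ht
    refine ((hA.const_mul 2).exp.div hα hne).congr_deriv ?_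
    field_simp
  have hratio : ∀ t ≥ t₀, |deriv α t / α t / α t| ≤ 1 := by
    intro t ht
    have hp := hα_pos t (ht₀.le.trans ht)
    rw [abs_div, abs_of_pos hp, div_le_one hp]
    exact (hL t (ht₀.le.trans ht)).trans (hlarge t ht)
  have hmono : ∀ {H H' : ℝ → ℝ}, (∀ t > 0, HasDerivAt H (H' t) t) → (∀ t ≥ t₀, 0 ≤ H' t) →
      ∀ t ≥ t₀, H t₀ ≤ H t := by
    intro H H' hH hH' t ht
    refine monotoneOn_of_hasDerivWithinAt_nonneg (f' := H') (convex_Ici t₀)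
      (fun s hs => (hH s (ht₀.trans_le hs)).continuousAt.continuousWithinAt) ?_ ?_
      (Set.mem_Ici.2 le_rfl) ht ht
    · intro s hs
      rw [interior_Ici] at hs
      exact (hH s (ht₀.trans hs)).hasDerivWithinAt
    · intro s hs
      rw [interior_Ici] at hs
      exact hH' s (le_of_lt hs)
  have hGF := hmono (fun t ht => (hGderiv t ht).sub (hFderiv t ht)) fun t ht => by
    have := abs_le.1 (hratio t ht)
    nlinarith [Real.exp_pos (2 * Aint α t)]
  have hFG := hmono (fun t ht => ((hFderiv t ht).const_mul 3).sub (hGderiv t ht)) fun t ht => by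
    have := abs_le.1 (hratio t ht)
    nlinarith [Real.exp_pos (2 * Aint α t)]
  have hFmono := hmono hFderiv fun t _ => (Real.exp_pos _).le
  have hGmono := hmono hGderiv fun t ht => by
    have := abs_le.1 (hratio t ht)
    exact mul_nonneg (Real.exp_pos _).le (by linarith)
  simp only [Pi.sub_apply] at hGF hFG
  have hG₀ : 0 < G t₀ := div_pos (Real.exp_pos _) (hα_pos t₀ ht₀.le)
  have hF₀ : 0 < F t₀ := by
    refine intervalIntegral.intervalIntegral_pos_of_pos
      (hEcont.mono ?_).intervalIntegrable (fun _ => Real.exp_pos _) ht₀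
    rw [Set.uIcc_of_le ht₀.le]
    exact Set.Icc_subset_Ici_self
  have hlower : ∀ t ≥ t₀, (3 + G t₀ / F t₀)⁻¹ * G t ≤ F t := by
    intro t ht
    rw [inv_mul_le_iff₀ (by positivity), add_mul]
    have : G t₀ ≤ G t₀ / F t₀ * F t := by
      rw [div_mul_eq_mul_div, le_div_iff₀ hF₀]
      exact mul_le_mul_of_nonneg_left (hFmono t ht) hG₀.le
    linarith [hFG t ht]
  have hupper : ∀ t ≥ t₀, F t ≤ (1 + F t₀ / G t₀) * G t := by
    intro t ht
    have : F t₀ ≤ F t₀ / G t₀ * G t := by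
      rw [div_mul_eq_mul_div, le_div_iff₀ hG₀]
      exact mul_le_mul_of_nonneg_left (hGmono t ht) hF₀.le
    linarith [hGF t ht]
  have hscale : ∀ t k : ℝ, k / α t = Real.exp (-(2 * Aint α t)) * (k * G t) := by
    intro t k
    simp only [hG, Real.exp_neg]
    field_simp
  refine ⟨(3 + G t₀ / F t₀)⁻¹, 1 + F t₀ / G t₀, t₀, by positivity, ?_, ht₀, fun t ht =>
    ⟨Kker_self_eq_integral α t, ?_, ?_⟩⟩
  · exact le_of_mul_le_mul_right ((hlower t₀ le_rfl).trans (hupper t₀ le_rfl)) hG₀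
  · rw [hscale, Kker_self]
    exact mul_le_mul_of_nonneg_left (hlower t ht) (Real.exp_pos _).le
  · rw [hscale, Kker_self]
    exact mul_le_mul_of_nonneg_left (hupper t ht) (Real.exp_pos _).le
end

section
/- Let (X_t)_{t≥0} be an infinite time horizon Brownian bridge with almost surely continuous sample paths whose coefficient α satisfies the growth conditions (i) and (ii). Let N > 1 and let m be an even positive integer such that mγ > 2, 2N/m < β, and 2γ < 1 − 2N/(βm), where γ ∈ (0,1/2] and β > 0 are the parameters from condition (i). Then there exists an almost surely finite random variable R (independent of k) such that almost surely, for every integer k ≥ 1 and all t₁, t₂ ∈ [k, k+1], |X_{t₂} − X_{t₁}| ≤ R · k^{−β(1 − 2γ − 2N/(βm))/2}. -/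
open MeasureTheory ProbabilityTheory Real Filter Set

/-- Dyadic chaining: control of all dyadic increments of level `n` by `B * q ^ n` controls the
oscillation of a continuous function on the unit interval. -/
theorem abs_sub_le_of_dyadic_increments {f : ℝ → ℝ} {B q : ℝ} (hf : ContinuousOn f (Icc 0 1))
    (hB : 0 ≤ B) (hq0 : 0 ≤ q) (hq1 : q < 1)
    (h : ∀ n j : ℕ, j < 2 ^ n → |f ((j + 1 : ℝ) / 2 ^ n) - f ((j : ℝ) / 2 ^ n)| ≤ B * q ^ n)
    {t : ℝ} (ht : t ∈ Icc (0 : ℝ) 1) : |f t - f 0| ≤ B / (1 - q) := by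
  have hgeom : ∀ n : ℕ, B * ∑ i ∈ Finset.range n, q ^ i ≤ B / (1 - q) := by
    intro n
    rw [div_eq_mul_inv, ← tsum_geometric_of_lt_one hq0 hq1]
    exact mul_le_mul_of_nonneg_left
      ((summable_geometric_of_lt_one hq0 hq1).sum_le_tsum _ (fun i _ => by positivity)) hB
  have hdy : ∀ n j : ℕ, j ≤ 2 ^ n →
      |f ((j : ℝ) / 2 ^ n) - f 0| ≤ B * ∑ i ∈ Finset.range (n + 1), q ^ i := by
    intro n
    induction n with
    | zero =>
      intro j hj
      have : j = 0 ∨ j = 1 := by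
        simp only [pow_zero] at hj
        omega
      rcases this with rfl | rfl
      · simpa using hB
      · simpa using h 0 0 (by norm_num)
    | succ n ih =>
      intro j hj
      rw [Finset.sum_range_succ, mul_add]
      have hpow : (2 : ℕ) ^ (n + 1) = 2 * 2 ^ n := by ring
      have hhalf : ∀ i : ℕ, ((2 * i : ℕ) : ℝ) / 2 ^ (n + 1) = (i : ℝ) / 2 ^ n := by
        intro i
        push_cast
        rw [pow_succ]
        field_simp
      rcases Nat.even_or_odd' j with ⟨i, rfl | rfl⟩
      · rw [hhalf]
        have := ih i (by omega)
        have : 0 ≤ B * q ^ (n + 1) := by positivity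
        linarith
      · have h1 := ih i (by omega)
        have h2 := h (n + 1) (2 * i) (by omega)
        rw [hhalf] at h2
        have h3 : ((2 * i + 1 : ℕ) : ℝ) = ((2 * i : ℕ) : ℝ) + 1 := by push_cast; ring
        rw [h3]
        calc _ ≤ _ := abs_sub_le _ (f ((i : ℝ) / 2 ^ n)) _
          _ ≤ _ := by linarith
  have hlim : Tendsto (fun n : ℕ => ((⌊t * 2 ^ n⌋₊ : ℕ) : ℝ) / 2 ^ n) atTop (nhds t) :=
    (tendsto_nat_floor_mul_div_atTop ht.1).comp
      (tendsto_pow_atTop_atTop_of_one_lt (by norm_num : (1 : ℝ) < 2))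
  have hfloor : ∀ n : ℕ, ⌊t * 2 ^ n⌋₊ ≤ 2 ^ n := by
    intro n
    apply Nat.floor_le_of_le
    push_cast
    have : (0 : ℝ) ≤ 2 ^ n := by positivity
    nlinarith [ht.2]
  have hmem : ∀ n : ℕ, ((⌊t * 2 ^ n⌋₊ : ℕ) : ℝ) / 2 ^ n ∈ Icc (0 : ℝ) 1 := by
    intro n
    refine ⟨by positivity, div_le_one_of_le₀ ?_ (by positivity)⟩
    exact_mod_cast hfloor n
  have hlim' : Tendsto (fun n : ℕ => |f (((⌊t * 2 ^ n⌋₊ : ℕ) : ℝ) / 2 ^ n) - f 0|) atTop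
      (nhds |f t - f 0|) :=
    (((hf t ht).tendsto.comp (tendsto_nhdsWithin_iff.2 ⟨hlim, Eventually.of_forall hmem⟩)).sub_const
      _).abs
  exact le_of_tendsto' hlim' fun n => (hdy n _ (hfloor n)).trans (hgeom _)

/-- A countable family of nonnegative random variables with summable expectations is almost surely
bounded. -/
theorem exists_ae_bound_of_summable_integral {Ω ι : Type*} [MeasurableSpace Ω] [Countable ι]
    {P : Measure Ω} {g : ι → Ω → ℝ} (hint : ∀ i, Integrable (g i) P) (h0 : ∀ i ω, 0 ≤ g i ω)
    {c : ι → ℝ} (hc : Summable c) (hle : ∀ i, ∫ ω, g i ω ∂P ≤ c i) :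
    ∃ R : Ω → ℝ, (∀ ω, 0 ≤ R ω) ∧ ∀ᵐ ω ∂P, ∀ i, g i ω ≤ R ω := by
  refine ⟨fun ω => (∑' i, ENNReal.ofReal (g i ω)).toReal, fun ω => ENNReal.toReal_nonneg, ?_⟩
  have hmeas : ∀ i, AEMeasurable (fun ω => ENNReal.ofReal (g i ω)) P :=
    fun i => (hint i).aemeasurable.ennreal_ofReal
  have hfin : ∫⁻ ω, ∑' i, ENNReal.ofReal (g i ω) ∂P ≠ ⊤ := by
    rw [lintegral_tsum hmeas]
    refine ne_top_of_le_ne_top hc.tsum_ofReal_ne_top (ENNReal.tsum_le_tsum fun i => ?_)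
    rw [← ofReal_integral_eq_lintegral_ofReal (hint i) (Eventually.of_forall (h0 i))]
    exact ENNReal.ofReal_le_ofReal (hle i)
  filter_upwards [ae_lt_top' (AEMeasurable.tsum hmeas) hfin] with ω hω i
  rw [← ENNReal.ofReal_le_iff_le_toReal hω.ne]
  exact ENNReal.le_tsum i

/-- Scaling of the absolute moments of centered Gaussian variables. -/
theorem integral_abs_pow_of_map_eq_gaussianReal {Ω : Type*} [MeasurableSpace Ω] {P : Measure Ω}
    {Y : Ω → ℝ} {v : NNReal} (hY : P.map Y = gaussianReal 0 v) (m : ℕ) :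
    Integrable (fun ω => |Y ω| ^ m) P ∧
      ∫ ω, |Y ω| ^ m ∂P = √(v : ℝ) ^ m * ∫ z, |z| ^ m ∂(gaussianReal 0 1) := by
  have hYm : AEMeasurable Y P := by
    refine AEMeasurable.of_map_ne_zero ?_
    rw [hY]
    exact IsProbabilityMeasure.ne_zero _
  have hmeas : Measurable fun y : ℝ => |y| ^ m := by fun_prop
  have hint : ∀ w : NNReal, Integrable (fun y : ℝ => |y| ^ m) (gaussianReal 0 w) := by
    intro w
    simpa using (memLp_id_gaussianReal (μ := 0) (v := w) m).integrable_norm_pow'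
  constructor
  · have := hint v
    rw [← hY, integrable_map_measure hmeas.aestronglyMeasurable hYm] at this
    exact this
  · rw [← integral_map (f := fun y : ℝ => |y| ^ m) hYm hmeas.aestronglyMeasurable, hY]
    have hscale : gaussianReal 0 v = (gaussianReal 0 1).map (√(v : ℝ) * ·) := by
      rw [gaussianReal_map_const_mul]
      congr 1
      · simp
      · ext
        simp [Real.sq_sqrt]
    rw [hscale, integral_map (by fun_prop) hmeas.aestronglyMeasurable, ← integral_const_mul]
    refine integral_congr_ae (Eventually.of_forall fun z => ?_)
    simp only [abs_mul, mul_pow, abs_of_nonneg (Real.sqrt_nonneg _)]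

/-- A Kolmogorov-type criterion on the intervals `[k, k + 1]`: moment bounds on increments give
almost sure oscillation bounds, uniformly in `k` up to the factor `k ^ (N / m)`. -/
theorem exists_ae_oscillation_bound {Ω : Type*} [MeasurableSpace Ω] {P : Measure Ω}
    {X : ℝ → Ω → ℝ} (hpath : ∀ᵐ ω ∂P, ContinuousOn (fun t => X t ω) (Ici 0))
    {D : ℕ → ℝ} (hD : ∀ k : ℕ, 1 ≤ k → 0 < D k) {γ N C : ℝ} {m : ℕ} (hm : 2 < (m : ℝ) * γ)
    (hN : 1 < N)
    (hmom : ∀ k : ℕ, 1 ≤ k → ∀ s ∈ Icc (k : ℝ) (k + 1), ∀ t ∈ Icc (k : ℝ) (k + 1), s ≤ t →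
      Integrable (fun ω => |X t ω - X s ω| ^ m) P ∧
        ∫ ω, |X t ω - X s ω| ^ m ∂P ≤ C * ((t - s) ^ γ * D k) ^ m) :
    ∃ R : Ω → ℝ, ∀ᵐ ω ∂P, ∀ k : ℕ, 1 ≤ k →
      ∀ t₁ ∈ Icc (k : ℝ) (k + 1), ∀ t₂ ∈ Icc (k : ℝ) (k + 1),
        |X t₂ ω - X t₁ ω| ≤ R ω * ((k : ℝ) ^ (N / m) * D k) := by
  have hm0 : m ≠ 0 := by
    rintro rfl
    norm_num at hm
  have hmpos : (0 : ℝ) < m := by positivity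
  let pt : ℕ → ℕ → ℕ → ℝ := fun k n j => (k : ℝ) + (j : ℝ) / 2 ^ n
  have hpt : ∀ k n j : ℕ, j ≤ 2 ^ n → pt k n j ∈ Icc (k : ℝ) (k + 1) := by
    intro k n j hj
    have h1 : (0 : ℝ) ≤ (j : ℝ) / 2 ^ n := by positivity
    have h2 : (j : ℝ) / 2 ^ n ≤ 1 := by
      apply div_le_one_of_le₀ _ (by positivity)
      exact_mod_cast hj
    exact ⟨by simp only [pt]; linarith, by simp only [pt]; linarith⟩
  have hptsub : ∀ k n j : ℕ, pt k n (j + 1) - pt k n j = ((2 : ℝ) ^ n)⁻¹ := by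
    intro k n j
    simp only [pt]
    push_cast
    field_simp
    ring
  let w : ℕ → ℕ → ℝ := fun k n => (k : ℝ) ^ (-N) * (D k ^ m)⁻¹ * 2 ^ n
  let g : ℕ × ℕ → Ω → ℝ := fun p ω => w (p.1 + 1) p.2 *
    ∑ j ∈ Finset.range (2 ^ p.2),
      |X (pt (p.1 + 1) p.2 (j + 1)) ω - X (pt (p.1 + 1) p.2 j) ω| ^ m
  have hw : ∀ k n : ℕ, 1 ≤ k → 0 < w k n := by
    intro k n hk
    have := hD k hk
    have hk' : (0 : ℝ) < k := by exact_mod_cast hk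
    positivity
  have hinc : ∀ k n j : ℕ, 1 ≤ k → j < 2 ^ n →
      Integrable (fun ω => |X (pt k n (j + 1)) ω - X (pt k n j) ω| ^ m) P ∧
        ∫ ω, |X (pt k n (j + 1)) ω - X (pt k n j) ω| ^ m ∂P
          ≤ C * ((((2 : ℝ) ^ n)⁻¹) ^ γ * D k) ^ m := by
    intro k n j hk hj
    have h := hmom k hk (pt k n j) (hpt k n j hj.le) (pt k n (j + 1)) (hpt k n (j + 1) hj)
      (by
        have := hptsub k n j
        have h2 : (0 : ℝ) < ((2 : ℝ) ^ n)⁻¹ := by positivity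
        linarith)
    rwa [hptsub] at h
  have hgint : ∀ p, Integrable (g p) P := by
    intro p
    refine (integrable_finsetSum _ fun j hj => ?_).const_mul _
    exact (hinc _ _ _ (by omega) (Finset.mem_range.1 hj)).1
  have hg0 : ∀ p ω, 0 ≤ g p ω := by
    intro p ω
    exact mul_nonneg (hw _ _ (by omega)).le (Finset.sum_nonneg fun j _ => by positivity)
  let ρ : ℝ := (2 : ℝ) ^ (2 - (m : ℝ) * γ)
  have hρ1 : ρ < 1 := Real.rpow_lt_one_of_one_lt_of_neg (by norm_num) (by linarith)
  have hρ0 : 0 ≤ ρ := by positivity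
  have hsum : Summable fun p : ℕ × ℕ => (((p.1 + 1 : ℕ) : ℝ) ^ (-N)) * (C * ρ ^ p.2) := by
    have h1 : Summable fun k : ℕ => ((k + 1 : ℕ) : ℝ) ^ (-N) :=
      (summable_nat_add_iff (f := fun k : ℕ => (k : ℝ) ^ (-N)) 1).2
        (Real.summable_nat_rpow.2 (by linarith))
    have h2 := (h1.mul_of_nonneg (summable_geometric_of_lt_one hρ0 hρ1)
      (fun k => by positivity) (fun n => by positivity)).mul_left C
    refine h2.congr fun p => ?_
    ring
  have hgle : ∀ p, ∫ ω, g p ω ∂P ≤ (((p.1 + 1 : ℕ) : ℝ) ^ (-N)) * (C * ρ ^ p.2) := by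
    rintro ⟨k', n⟩
    obtain ⟨k, hk⟩ : ∃ k, k = k' + 1 := ⟨_, rfl⟩
    have hk1 : 1 ≤ k := by omega
    have hDk := hD k hk1
    simp only [g, ← hk]
    rw [integral_const_mul, integral_finsetSum _ fun j hj =>
      (hinc k n j hk1 (Finset.mem_range.1 hj)).1]
    have hsumle := Finset.sum_le_sum fun j hj => (hinc k n j hk1 (Finset.mem_range.1 hj)).2
    rw [Finset.sum_const, Finset.card_range, nsmul_eq_mul] at hsumle
    refine (mul_le_mul_of_nonneg_left hsumle (hw k n hk1).le).trans (le_of_eq ?_)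
    have hρn : ρ ^ n = 2 ^ n * 2 ^ n * ((((2 : ℝ) ^ n)⁻¹) ^ γ) ^ m := by
      have e1 : (2 : ℝ) ^ n = (2 : ℝ) ^ (n : ℝ) := (Real.rpow_natCast 2 n).symm
      simp only [ρ]
      rw [e1, ← Real.rpow_neg (by norm_num), ← Real.rpow_mul (by norm_num), ← Real.rpow_natCast,
        ← Real.rpow_natCast, ← Real.rpow_mul (by norm_num), ← Real.rpow_mul (by norm_num),
        ← Real.rpow_add (by norm_num), ← Real.rpow_add (by norm_num)]
      congr 1
      ring
    rw [hρn]
    simp only [w]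
    push_cast
    rw [mul_pow]
    field_simp
  obtain ⟨R, hR0, hR⟩ := exists_ae_bound_of_summable_integral hgint hg0 hsum hgle
  let q : ℝ := (2 : ℝ) ^ (-(1 / (m : ℝ)))
  have hq1 : q < 1 := Real.rpow_lt_one_of_one_lt_of_neg (by norm_num)
    (neg_lt_zero.2 (by positivity))
  have hq0 : 0 ≤ q := by positivity
  have hqm : q ^ m = 2⁻¹ := by
    simp only [q]
    rw [← Real.rpow_natCast, ← Real.rpow_mul (by norm_num), neg_mul, one_div,
      inv_mul_cancel₀ hmpos.ne', Real.rpow_neg_one]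
  refine ⟨fun ω => 2 * (R ω ^ (1 / (m : ℝ)) / (1 - q)), ?_⟩
  filter_upwards [hpath, hR] with ω hcont hω k hk t₁ ht₁ t₂ ht₂
  have hk' : (0 : ℝ) < k := by exact_mod_cast hk
  have hDk := hD k hk
  set B : ℝ := R ω ^ (1 / (m : ℝ)) * ((k : ℝ) ^ (N / m) * D k) with hBdef
  have hB0 : 0 ≤ B := by
    have := hR0 ω
    positivity
  have hBm : B ^ m = R ω * ((k : ℝ) ^ N * D k ^ m) := by
    rw [hBdef, mul_pow, mul_pow, ← Real.rpow_natCast (R ω ^ _), ← Real.rpow_mul (hR0 ω),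
      ← Real.rpow_natCast ((k : ℝ) ^ _), ← Real.rpow_mul hk'.le, one_div,
      inv_mul_cancel₀ hmpos.ne', div_mul_cancel₀ _ hmpos.ne', Real.rpow_one]
  have hdy : ∀ n j : ℕ, j < 2 ^ n →
      |X ((k : ℝ) + ((j + 1 : ℝ) / 2 ^ n)) ω - X ((k : ℝ) + (j : ℝ) / 2 ^ n) ω| ≤ B * q ^ n := by
    intro n j hj
    refine le_of_pow_le_pow_left₀ hm0 (by positivity) ?_
    have h1 := hω (k - 1, n)
    simp only [g, Nat.sub_add_cancel hk] at h1
    have h2 := Finset.single_le_sum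
      (f := fun j => |X (pt k n (j + 1)) ω - X (pt k n j) ω| ^ m)
      (fun j _ => by positivity) (Finset.mem_range.2 hj)
    have h3 := (mul_le_mul_of_nonneg_left h2 (hw k n hk).le).trans h1
    rw [mul_pow, hBm, ← pow_mul, mul_comm n m, pow_mul, hqm]
    have h4 := (le_div_iff₀' (hw k n hk)).2 h3
    simp only [pt] at h4
    push_cast at h4
    refine h4.trans (le_of_eq ?_)
    simp only [w]
    rw [Real.rpow_neg hk'.le, inv_pow]
    field_simp
  have hcont' : ContinuousOn (fun t => X ((k : ℝ) + t) ω) (Icc 0 1) := by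
    refine hcont.comp (f := fun t : ℝ => (k : ℝ) + t) (by fun_prop) fun t ht => ?_
    exact add_nonneg hk'.le ht.1
  have hosc : ∀ t ∈ Icc (k : ℝ) (k + 1), |X t ω - X k ω| ≤ B / (1 - q) := by
    intro t ht
    have := abs_sub_le_of_dyadic_increments hcont' hB0 hq0 hq1 hdy (t := t - k)
      ⟨by linarith [ht.1], by linarith [ht.2]⟩
    simpa using this
  have h1 := hosc t₁ ht₁
  have h2 := hosc t₂ ht₂
  rw [abs_sub_comm] at h1
  have h3 := abs_sub_le (X t₂ ω) (X k ω) (X t₁ ω)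
  calc _ ≤ 2 * (B / (1 - q)) := by linarith
    _ = _ := by
      rw [hBdef]
      ring

theorem continuous_Aint {a : ℝ → ℝ} (ha : Continuous a) : Continuous (Aint a) :=
  intervalIntegral.continuous_primitive (fun _ _ => ha.intervalIntegrable _ _) 0

theorem Aint_sub {a : ℝ → ℝ} (ha : Continuous a) (s t : ℝ) :
    Aint a t - Aint a s = ∫ u in s..t, a u :=
  intervalIntegral.integral_interval_sub_left (ha.intervalIntegrable _ _)
    (ha.intervalIntegrable _ _)

theorem monotone_Aint {a : ℝ → ℝ} (ha : Continuous a) (hpos : ∀ t, 0 < a t) :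
    Monotone (Aint a) := by
  intro s t hst
  rw [← sub_nonneg, Aint_sub ha]
  exact intervalIntegral.integral_nonneg hst fun u _ => (hpos u).le

theorem Kker_nonneg (a : ℝ → ℝ) {s t : ℝ} (hs : 0 ≤ s) (ht : 0 ≤ t) : 0 ≤ Kker a s t :=
  mul_nonneg (Real.exp_pos _).le
    (intervalIntegral.integral_nonneg (le_min hs ht) fun _ _ => (Real.exp_pos _).le)

/-- The covariance kernel only depends on the coefficient on `[0, ∞)`. -/
theorem Kker_congr {a b : ℝ → ℝ} (h : EqOn a b (Ici 0)) {s t : ℝ} (hs : 0 ≤ s) (ht : 0 ≤ t) :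
    Kker a s t = Kker b s t := by
  have hA : ∀ r : ℝ, 0 ≤ r → Aint a r = Aint b r := by
    intro r hr
    refine intervalIntegral.integral_congr fun u hu => h ?_
    rw [uIcc_of_le hr] at hu
    exact hu.1
  rw [Kker, Kker, hA s hs, hA t ht]
  congr 1
  refine intervalIntegral.integral_congr fun u hu => ?_
  rw [uIcc_of_le (le_min hs ht)] at hu
  simp only [hA u hu.1]

theorem Kker_increment_le {a : ℝ → ℝ} (ha : Continuous a) (hpos : ∀ t, 0 < a t) {s t : ℝ}
    (hs : 0 ≤ s) (hst : s ≤ t) :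
    Kker a t t - 2 * Kker a s t + Kker a s s ≤
      Kker a s s * (Aint a t - Aint a s) + (t - s) := by
  have hAc := continuous_Aint ha
  have hmono := monotone_Aint ha hpos
  set I : ℝ → ℝ := fun r => ∫ u in (0 : ℝ)..r, Real.exp (2 * Aint a u) with hI
  have hec : Continuous fun u => Real.exp (2 * Aint a u) := by fun_prop
  have hItI : I t - I s ≤ (t - s) * Real.exp (2 * Aint a t) := by
    have h1 : I t - I s = ∫ u in s..t, Real.exp (2 * Aint a u) :=
      intervalIntegral.integral_interval_sub_left (hec.intervalIntegrable _ _)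
        (hec.intervalIntegrable _ _)
    rw [h1]
    calc _ ≤ ∫ u in s..t, Real.exp (2 * Aint a t) :=
          intervalIntegral.integral_mono_on hst (hec.intervalIntegrable _ _)
            (continuous_const.intervalIntegrable _ _) fun u hu =>
              Real.exp_le_exp.2 (by linarith [hmono hu.2])
      _ = _ := by simp
  have hIs : 0 ≤ I s := intervalIntegral.integral_nonneg hs fun _ _ => (Real.exp_pos _).le
  set x : ℝ := Aint a t - Aint a s with hx
  have hx0 : 0 ≤ x := sub_nonneg.2 (hmono hst)
  set E : ℝ := Real.exp (-Aint a s) with hE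
  set F : ℝ := Real.exp (-Aint a t) with hF
  have hK1 : Kker a t t = F * F * I t := by
    rw [Kker, min_self, hF, ← Real.exp_add, sub_eq_add_neg]
  have hK2 : Kker a s t = E * F * I s := by
    rw [Kker, min_eq_left hst, hF, hE, ← Real.exp_add, sub_eq_add_neg]
  have hK3 : Kker a s s = E * E * I s := by
    rw [Kker, min_self, hE, ← Real.exp_add, sub_eq_add_neg]
  have hFE : F = E * Real.exp (-x) := by
    rw [hF, hE, ← Real.exp_add, hx]
    congr 1
    ring
  have hFF : F * F * Real.exp (2 * Aint a t) = 1 := by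
    rw [hF, ← Real.exp_add, ← Real.exp_add, Real.exp_eq_one_iff]
    ring
  have hy0 := Real.exp_pos (-x)
  have hy1 : Real.exp (-x) ≤ 1 := Real.exp_le_one_iff.2 (by linarith)
  have hyx := Real.add_one_le_exp (-x)
  have hsq : (1 - Real.exp (-x)) ^ 2 ≤ x := by nlinarith
  have hlast : F * F * (I t - I s) ≤ t - s := by
    calc _ ≤ F * F * ((t - s) * Real.exp (2 * Aint a t)) :=
          mul_le_mul_of_nonneg_left hItI (mul_self_nonneg F)
      _ = (t - s) * (F * F * Real.exp (2 * Aint a t)) := by ring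
      _ = _ := by rw [hFF, mul_one]
  calc Kker a t t - 2 * Kker a s t + Kker a s s
      = E * E * I s * (1 - Real.exp (-x)) ^ 2 + F * F * (I t - I s) := by
        rw [hK1, hK2, hK3, hFE]
        ring
    _ ≤ _ := by
        rw [hK3]
        exact add_le_add (mul_le_mul_of_nonneg_left hsq
          (mul_nonneg (mul_self_nonneg E) hIs)) hlast

theorem Kker_self_le {a : ℝ → ℝ} (ha : Continuous a) (hpos : ∀ t, 0 < a t) {s b : ℝ}
    (hs : 1 ≤ s) (hb : 0 < b) (hlow : ∀ u ∈ Ioo (s - 1) s, b ≤ a u) :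
    Kker a s s ≤ 1 / (2 * b) + s * Real.exp (-(2 * b)) := by
  have hAc := continuous_Aint ha
  have hmono := monotone_Aint ha hpos
  have hnear : ∀ u ∈ Icc (s - 1) s, b * (s - u) ≤ Aint a s - Aint a u := by
    intro u hu
    rw [Aint_sub ha]
    calc b * (s - u) = ∫ _ in u..s, b := by simp [mul_comm]
      _ ≤ _ := intervalIntegral.integral_mono_on_of_le_Ioo hu.2
        (continuous_const.intervalIntegrable _ _) (ha.intervalIntegrable _ _)
        fun v hv => hlow v ⟨by linarith [hu.1, hv.1], hv.2⟩
  have hpt : ∀ u ∈ Icc 0 s, Real.exp (-Aint a s - Aint a s) * Real.exp (2 * Aint a u) ≤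
      Real.exp (-(2 * b) * (s - u)) + Real.exp (-(2 * b)) := by
    intro u hu
    rw [← Real.exp_add]
    rcases le_total (s - 1) u with h | h
    · have := hnear u ⟨h, hu.2⟩
      have h2 : Real.exp (-Aint a s - Aint a s + 2 * Aint a u) ≤ Real.exp (-(2 * b) * (s - u)) :=
        Real.exp_le_exp.2 (by linarith)
      linarith [Real.exp_pos (-(2 * b))]
    · have h1 := hnear (s - 1) ⟨le_rfl, by linarith⟩
      have h3 := hmono h
      have h2 : Real.exp (-Aint a s - Aint a s + 2 * Aint a u) ≤ Real.exp (-(2 * b)) :=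
        Real.exp_le_exp.2 (by linarith)
      linarith [Real.exp_pos (-(2 * b) * (s - u))]
  have hprim : ∫ u in (0 : ℝ)..s, Real.exp (-(2 * b) * (s - u)) =
      1 / (2 * b) - Real.exp (-(2 * b) * s) / (2 * b) := by
    rw [intervalIntegral.integral_eq_sub_of_hasDerivAt
      (f := fun u => Real.exp (-(2 * b) * (s - u)) / (2 * b))]
    · simp
    · intro u _
      have h1 : HasDerivAt (fun u => -(2 * b) * (s - u)) (-(2 * b) * -1) u :=
        ((hasDerivAt_id' u).const_sub s).const_mul _
      refine (h1.exp.div_const (2 * b)).congr_deriv ?_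
      field_simp
    · exact Continuous.intervalIntegrable (by fun_prop) _ _
  rw [Kker, min_self, ← intervalIntegral.integral_const_mul]
  calc _ ≤ ∫ u in (0 : ℝ)..s, (Real.exp (-(2 * b) * (s - u)) + Real.exp (-(2 * b))) :=
        intervalIntegral.integral_mono_on (by linarith)
          (Continuous.intervalIntegrable (by fun_prop) _ _)
          (Continuous.intervalIntegrable (by fun_prop) _ _) hpt
    _ = 1 / (2 * b) - Real.exp (-(2 * b) * s) / (2 * b) + s * Real.exp (-(2 * b)) := by
        rw [intervalIntegral.integral_add (Continuous.intervalIntegrable (by fun_prop) _ _)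
          (Continuous.intervalIntegrable (by fun_prop) _ _), hprim]
        simp
    _ ≤ _ := by
        have : 0 ≤ Real.exp (-(2 * b) * s) / (2 * b) := by positivity
        linarith

theorem rpow_le_mul_exp {p b x : ℝ} (hp : 0 < p) (hb : 0 < b) (hx : 0 ≤ x) :
    x ^ p ≤ (p / b) ^ p * Real.exp (b * x) := by
  have h1 : x * (b / p) ≤ Real.exp (b * x / p) := by
    have := Real.add_one_le_exp (b * x / p)
    have e : x * (b / p) = b * x / p := by ring
    linarith
  have h2 := Real.rpow_le_rpow (by positivity) h1 hp.le
  rw [← Real.exp_mul, div_mul_cancel₀ _ hp.ne', Real.mul_rpow hx (by positivity)] at h2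
  have h3 : (p / b) ^ p * (b / p) ^ p = 1 := by
    rw [← Real.mul_rpow (by positivity) (by positivity), div_mul_div_cancel₀ hb.ne', div_self hp.ne',
      Real.one_rpow]
  calc x ^ p = (p / b) ^ p * (x ^ p * (b / p) ^ p) := by linear_combination (-x ^ p) * h3
    _ ≤ _ := mul_le_mul_of_nonneg_left h2 (by positivity)

/-- A Harnack inequality for coefficients with bounded logarithmic derivative. -/
theorem exists_harnack {α : ℝ → ℝ} (hpos : ∀ t ≥ (0 : ℝ), 0 < α t)
    (hdiff : ContDiffOn ℝ 1 α (Ici 0)) (hlog : ∃ C : ℝ, ∀ t ≥ (0 : ℝ), |deriv α t / α t| ≤ C) :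
    ∃ H > (0 : ℝ), ∀ s > (0 : ℝ), ∀ t > (0 : ℝ), |s - t| ≤ 1 → α s ≤ H * α t := by
  obtain ⟨C, hC⟩ := hlog
  have hC0 : 0 ≤ C := (abs_nonneg _).trans (hC 0 le_rfl)
  have hd : ∀ x ∈ Ioi (0 : ℝ), DifferentiableAt ℝ α x := fun x hx =>
    (hdiff.differentiableOn one_ne_zero x (mem_Ici.2 (le_of_lt hx))).differentiableAt (Ici_mem_nhds hx)
  refine ⟨Real.exp C, Real.exp_pos C, fun s hs t ht hst => ?_⟩
  have h := Convex.norm_image_sub_le_of_norm_deriv_le (𝕜 := ℝ) (f := fun x => Real.log (α x))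
    (s := Ioi 0) (x := t) (y := s) (C := C)
    (fun x hx => (hd x hx).log (hpos x (le_of_lt hx)).ne')
    (fun x hx => by
      rw [deriv.log (hd x hx) (hpos x (le_of_lt hx)).ne']
      exact hC x (le_of_lt hx))
    (convex_Ioi 0) ht hs
  simp only [Real.norm_eq_abs] at h
  have h2 : Real.log (α s) ≤ C + Real.log (α t) := by
    have := (le_abs_self _).trans (h.trans (mul_le_of_le_one_right hC0 hst))
    linarith
  calc α s = Real.exp (Real.log (α s)) := (Real.exp_log (hpos s hs.le)).symm
    _ ≤ Real.exp (C + Real.log (α t)) := Real.exp_le_exp.2 h2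
    _ = _ := by rw [Real.exp_add, Real.exp_log (hpos t ht.le)]

theorem GrowthCond.exists_rpow_le {α : ℝ → ℝ} {γ β : ℝ} (hpos : ∀ t ≥ (0 : ℝ), 0 < α t)
    (hcont : ContinuousOn α (Ici 0)) (h : GrowthCond α γ β) :
    ∃ c > (0 : ℝ), ∀ t > (0 : ℝ), c * t ^ β ≤ α t := by
  obtain ⟨-, hγ, -, ⟨C, hC, hi⟩, -⟩ := h
  have h0 := hpos 0 le_rfl
  refine ⟨α 0 ^ (2 * γ) / C, by positivity, fun t ht => ?_⟩
  have hstar : α 0 ≤ alphaStar α (t + 1) := by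
    refine le_csSup ?_ ⟨0, ⟨le_rfl, by linarith⟩, rfl⟩
    exact (isCompact_Icc.image_of_continuousOn (hcont.mono fun x hx => hx.1)).bddAbove
  have h1 := hi t ht
  rw [div_le_iff₀ (hpos t ht.le)] at h1
  have h2 := (Real.rpow_le_rpow h0.le hstar (by linarith [hγ.1] : 0 ≤ 2 * γ)).trans h1
  have h3 : 0 < t ^ β := by positivity
  rw [Real.rpow_neg ht.le] at h2
  rw [div_mul_eq_mul_div, div_le_iff₀ hC]
  calc _ ≤ C * (t ^ β)⁻¹ * α t * t ^ β := mul_le_mul_of_nonneg_right h2 h3.le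
    _ = _ := by field_simp

/-- The constant extension of `α` to the left of `0`. -/
theorem exists_continuous_extension {α : ℝ → ℝ} (hpos : ∀ t ≥ (0 : ℝ), 0 < α t)
    (hcont : ContinuousOn α (Ici 0)) :
    ∃ a : ℝ → ℝ, Continuous a ∧ (∀ t, 0 < a t) ∧ EqOn α a (Ici 0) := by
  refine ⟨fun t => α (max t 0), ?_, fun t => hpos _ (le_max_right _ _), fun t ht => ?_⟩
  · exact hcont.comp_continuous (by fun_prop) fun t => mem_Ici.2 (le_max_right _ _)
  · simp only [max_eq_left (mem_Ici.1 ht)]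

/-- Under the growth conditions the variance at time `s` is of order at most `1 / α s`. -/
theorem GrowthCond.exists_Kker_self_le {α : ℝ → ℝ} {γ β : ℝ} (hpos : ∀ t ≥ (0 : ℝ), 0 < α t)
    (hcont : ContinuousOn α (Ici 0)) (h : GrowthCond α γ β) :
    ∃ M > (0 : ℝ), ∀ s ≥ (1 : ℝ), Kker α s s ≤ M / α s := by
  obtain ⟨H, hH, hHar⟩ := exists_harnack hpos h.1 h.2.2.2.2
  obtain ⟨c, hc, hgrow⟩ := h.exists_rpow_le hpos hcont
  have hβ : 0 < β := h.2.2.1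
  obtain ⟨a, ha, hapos, haeq⟩ := exists_continuous_extension hpos hcont
  set p : ℝ := 1 / β + 1 with hp
  have hp0 : 0 < p := by positivity
  set L : ℝ := (p / (2 / H)) ^ p with hL
  have hL0 : 0 ≤ L := by positivity
  refine ⟨H / 2 + (1 / c) ^ (1 / β) * L, by positivity, fun s hs => ?_⟩
  have hs0 : 0 < s := by linarith
  have hαs := hpos s hs0.le
  have hb : 0 < α s / H := by positivity
  have hK := Kker_self_le ha hapos hs hb fun u hu => by
    have hu0 : 0 < u := by linarith [hu.1]
    rw [← haeq (mem_Ici.2 hu0.le), div_le_iff₀' hH]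
    exact hHar s hs0 u hu0 (by rw [abs_le]; constructor <;> linarith [hu.1, hu.2])
  rw [← Kker_congr haeq hs0.le hs0.le] at hK
  have hsle : s ≤ (1 / c) ^ (1 / β) * α s ^ (1 / β) := by
    have h1 : s ^ β ≤ 1 / c * α s := by
      rw [one_div, ← div_eq_inv_mul, le_div_iff₀' hc]
      exact hgrow s hs0
    have h2 := Real.rpow_le_rpow (by positivity) h1 (by positivity : 0 ≤ 1 / β)
    rwa [← Real.rpow_mul hs0.le, mul_one_div_cancel hβ.ne', Real.rpow_one,
      Real.mul_rpow (by positivity) hαs.le] at h2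
  have hexp := rpow_le_mul_exp hp0 (by positivity : 0 < 2 / H) hαs.le
  rw [← hL] at hexp
  have hexp2 : Real.exp (-(2 * (α s / H))) * Real.exp (2 / H * α s) = 1 := by
    rw [← Real.exp_add, Real.exp_eq_one_iff]
    ring
  have hmain : s * Real.exp (-(2 * (α s / H))) * α s ≤ (1 / c) ^ (1 / β) * L := by
    have hpp : α s ^ p = α s ^ (1 / β) * α s := by
      rw [hp, Real.rpow_add hαs, Real.rpow_one]
    calc _ = s * α s * Real.exp (-(2 * (α s / H))) := by ring
      _ ≤ (1 / c) ^ (1 / β) * α s ^ (1 / β) * α s * Real.exp (-(2 * (α s / H))) := by gcongr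
      _ = (1 / c) ^ (1 / β) * α s ^ p * Real.exp (-(2 * (α s / H))) := by
        rw [hpp]
        ring
      _ ≤ (1 / c) ^ (1 / β) * (L * Real.exp (2 / H * α s)) * Real.exp (-(2 * (α s / H))) := by
        gcongr
      _ = (1 / c) ^ (1 / β) * L * (Real.exp (-(2 * (α s / H))) * Real.exp (2 / H * α s)) := by
        ring
      _ = _ := by rw [hexp2, mul_one]
  refine hK.trans ?_
  rw [add_div]
  refine add_le_add (le_of_eq ?_) ((le_div_iff₀ hαs).2 hmain)
  field_simp

theorem le_mul_rpow_mul_rpow {V L x y θ : ℝ} (hV : 0 ≤ V) (hL : 0 ≤ L) (hx : 0 ≤ x) (hy : 0 ≤ y)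
    (hθ0 : 0 ≤ θ) (hθ1 : θ ≤ 1) (hVx : V ≤ L * x) (hVy : V ≤ L * y) :
    V ≤ L * (x ^ θ * y ^ (1 - θ)) := by
  have hsplit : ∀ z : ℝ, 0 ≤ z → z ^ θ * z ^ (1 - θ) = z := by
    intro z hz
    rw [← Real.rpow_add_of_nonneg hz hθ0 (by linarith), add_sub_cancel, Real.rpow_one]
  calc V = V ^ θ * V ^ (1 - θ) := (hsplit V hV).symm
    _ ≤ (L * x) ^ θ * (L * y) ^ (1 - θ) := by
      have := sub_nonneg.2 hθ1
      gcongr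
    _ = (L ^ θ * L ^ (1 - θ)) * (x ^ θ * y ^ (1 - θ)) := by
      rw [Real.mul_rpow hL hx, Real.mul_rpow hL hy]
      ring
    _ = _ := by rw [hsplit L hL]

/-- Increments of the kernel on `[k, k + 1]`. -/
theorem GrowthCond.exists_Kker_increment_le {α : ℝ → ℝ} {γ β : ℝ}
    (hpos : ∀ t ≥ (0 : ℝ), 0 < α t) (hcont : ContinuousOn α (Ici 0)) (h : GrowthCond α γ β) :
    ∃ L > (0 : ℝ), ∀ k : ℕ, 1 ≤ k → ∀ s ∈ Icc (k : ℝ) (k + 1), ∀ t ∈ Icc (k : ℝ) (k + 1), s ≤ t →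
      Kker α t t - 2 * Kker α s t + Kker α s s ≤ L * (t - s) ∧
        Kker α t t - 2 * Kker α s t + Kker α s s ≤ L * (k : ℝ) ^ (-β) := by
  obtain ⟨H, hH, hHar⟩ := exists_harnack hpos h.1 h.2.2.2.2
  obtain ⟨c, hc, hgrow⟩ := h.exists_rpow_le hpos hcont
  obtain ⟨M, hM, hself⟩ := h.exists_Kker_self_le hpos hcont
  have hβ : 0 < β := h.2.2.1
  obtain ⟨a, ha, hapos, haeq⟩ := exists_continuous_extension hpos hcont
  refine ⟨max (M * H + 1) (2 * (M / c)), lt_max_of_lt_left (by positivity), ?_⟩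
  intro k hk s hs t ht hst
  have hk1 : (1 : ℝ) ≤ k := by exact_mod_cast hk
  have hk0 : (0 : ℝ) < k := by linarith
  have hs0 : 0 < s := by linarith [hs.1]
  have ht0 : 0 < t := by linarith [ht.1]
  have hαs := hpos s hs0.le
  constructor
  · have h1 := Kker_increment_le ha hapos hs0.le hst
    rw [← Kker_congr haeq hs0.le hs0.le, ← Kker_congr haeq ht0.le ht0.le,
      ← Kker_congr haeq hs0.le ht0.le] at h1
    have h2 : Aint a t - Aint a s ≤ H * α s * (t - s) := by
      rw [Aint_sub ha]
      calc _ ≤ ∫ _ in s..t, H * α s := by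
            refine intervalIntegral.integral_mono_on hst (ha.intervalIntegrable _ _)
              (continuous_const.intervalIntegrable _ _) fun u hu => ?_
            have hu0 : 0 < u := by linarith [hu.1]
            rw [← haeq (mem_Ici.2 hu0.le)]
            refine hHar u hu0 s hs0 ?_
            rw [abs_le]
            constructor <;> linarith [hu.1, hu.2, hs.1, ht.2]
        _ = _ := by
            simp
            ring
    have h3 : 0 ≤ Aint a t - Aint a s := sub_nonneg.2 (monotone_Aint ha hapos hst)
    have h4 : Kker α s s * (Aint a t - Aint a s) ≤ M / α s * (H * α s * (t - s)) :=
      mul_le_mul (hself s (by linarith [hs.1])) h2 h3 (by positivity)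
    have h5 : M / α s * (H * α s * (t - s)) = M * H * (t - s) := by field_simp
    calc _ ≤ (M * H + 1) * (t - s) := by linarith
      _ ≤ _ := mul_le_mul_of_nonneg_right (le_max_left _ _) (sub_nonneg.2 hst)
  · have hbd : ∀ r ∈ Icc (k : ℝ) (k + 1), Kker α r r ≤ M / c * (k : ℝ) ^ (-β) := by
      intro r hr
      have hr0 : 0 < r := by linarith [hr.1]
      have hkr : c * (k : ℝ) ^ β ≤ α r := by
        refine le_trans ?_ (hgrow r hr0)
        have := hr.1
        gcongr
      calc _ ≤ M / α r := hself r (by linarith [hr.1])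
        _ ≤ M / (c * (k : ℝ) ^ β) := by gcongr
        _ = _ := by
          rw [Real.rpow_neg hk0.le]
          field_simp
    have h1 := Kker_nonneg α hs0.le ht0.le
    calc _ ≤ 2 * (M / c) * (k : ℝ) ^ (-β) := by linarith [hbd s hs, hbd t ht]
      _ ≤ _ := mul_le_mul_of_nonneg_right (le_max_right _ _) (by positivity)

/-- Increments of a bridge are centered Gaussian with variance read off the kernel. -/
theorem IsBridge.map_increment {Ω : Type*} [MeasurableSpace Ω] {P : Measure Ω}
    {α : ℝ → ℝ} {X : ℝ → Ω → ℝ} (hX : IsBridge P α X) {s t : ℝ} (hs : 0 ≤ s) (ht : 0 ≤ t) :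
    ∃ v : NNReal, P.map (fun ω => X t ω - X s ω) = gaussianReal 0 v ∧
      (v : ℝ) = Kker α t t - 2 * Kker α s t + Kker α s s := by
  have hmarg : ∀ r : ℝ, 0 ≤ r → MemLp (X r) 2 P := by
    intro r hr
    obtain ⟨v, hv⟩ := hX.1 1 (fun _ => 1) (fun _ => r) (fun _ => hr)
    simp only [Fin.sum_univ_one, one_mul] at hv
    have hm : AEMeasurable (X r) P := by
      refine AEMeasurable.of_map_ne_zero ?_
      rw [hv]
      exact IsProbabilityMeasure.ne_zero _
    rw [memLp_two_iff_integrable_sq hm.aestronglyMeasurable]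
    simpa using (integral_abs_pow_of_map_eq_gaussianReal hv 2).1
  obtain ⟨v, hv⟩ := hX.1 2 ![1, -1] ![t, s] (by simp [Fin.forall_fin_two, hs, ht])
  simp only [Fin.sum_univ_two, Matrix.cons_val_zero, Matrix.cons_val_one, one_mul, neg_mul,
    ← sub_eq_add_neg] at hv
  refine ⟨v, hv, ?_⟩
  have hone : ∫ z, |z| ^ 2 ∂(gaussianReal 0 1) = 1 := by
    have h1 := variance_id_gaussianReal (μ := 0) (v := 1)
    rw [variance_of_integral_eq_zero (by fun_prop) (by simp)] at h1
    simpa using h1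
  have h2 := (integral_abs_pow_of_map_eq_gaussianReal hv 2).2
  rw [hone, mul_one, Real.sq_sqrt v.coe_nonneg] at h2
  rw [← h2, ← hX.2 t t ht ht, ← hX.2 s t hs ht, ← hX.2 s s hs hs]
  have htt : Integrable (fun ω => X t ω * X t ω) P :=
    (hmarg t ht).integrable_mul (hmarg t ht)
  have hst : Integrable (fun ω => X s ω * X t ω) P :=
    (hmarg s hs).integrable_mul (hmarg t ht)
  have hss : Integrable (fun ω => X s ω * X s ω) P :=
    (hmarg s hs).integrable_mul (hmarg s hs)
  rw [← integral_const_mul, ← integral_sub htt (hst.const_mul 2),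
    ← integral_add (f := fun ω => X t ω * X t ω - 2 * (X s ω * X t ω))
      (htt.sub (hst.const_mul 2)) hss]
  refine integral_congr_ae (Eventually.of_forall fun ω => ?_)
  simp only [sq_abs]
  ring

theorem stmt_4 {Ω : Type*} [MeasurableSpace Ω] (P : Measure Ω) [IsProbabilityMeasure P]
    (α : ℝ → ℝ) (X : ℝ → Ω → ℝ) (γ β : ℝ)
    (hα_pos : ∀ t ≥ (0:ℝ), 0 < α t)
    (hα_cont : ContinuousOn α (Set.Ici 0))
    (hgrowth : GrowthCond α γ β) (hγ : 0 < γ)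
    (hX : IsBridge P α X)
    (hpath : ∀ᵐ ω ∂P, ContinuousOn (fun t => X t ω) (Set.Ici 0))
    (N : ℝ) (hN : 1 < N) (m : ℕ) (hm_even : Even m) (hm_pos : 0 < m)
    (h1 : 2 < (m:ℝ) * γ) (h2 : 2 * N / (m:ℝ) < β) (h3 : 2 * γ < 1 - 2 * N / (β * (m:ℝ))) :
    ∃ R : Ω → ℝ, ∀ᵐ ω ∂P, ∀ k : ℕ, 1 ≤ k →
      ∀ t₁ ∈ Set.Icc (k:ℝ) (k+1), ∀ t₂ ∈ Set.Icc (k:ℝ) (k+1),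
        |X t₂ ω - X t₁ ω| ≤ R ω * (k:ℝ) ^ (-(β * (1 - 2*γ - 2*N/(β*(m:ℝ)))) / 2) := by
  obtain ⟨L, hL, hinc⟩ := hgrowth.exists_Kker_increment_le hα_pos hα_cont
  have hβ : 0 < β := hgrowth.2.2.1
  have hm0 : (0 : ℝ) < m := by exact_mod_cast hm_pos
  have hγ1 : 2 * γ ≤ 1 := by
    have : 0 ≤ 2 * N / (β * (m : ℝ)) := by positivity
    linarith
  set κ : ℝ := ∫ z, |z| ^ m ∂(gaussianReal 0 1) with hκ
  have hκ0 : 0 ≤ κ := integral_nonneg fun z => by positivity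
  obtain ⟨R, hR⟩ := exists_ae_oscillation_bound (P := P) (X := X) hpath
    (D := fun k : ℕ => (k : ℝ) ^ (-β * (1 - 2 * γ) / 2)) (C := √L ^ m * κ)
    (fun k hk => Real.rpow_pos_of_pos (by exact_mod_cast hk) _) h1 hN (by
      intro k hk s hs t ht hst
      have hk0 : (0 : ℝ) < k := by exact_mod_cast hk
      obtain ⟨v, hmap, hv⟩ := hX.map_increment (hk0.le.trans hs.1) (hk0.le.trans ht.1)
      obtain ⟨hint, hval⟩ := integral_abs_pow_of_map_eq_gaussianReal hmap m
      refine ⟨hint, ?_⟩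
      obtain ⟨hV1, hV2⟩ := hinc k hk s hs t ht hst
      rw [← hv] at hV1 hV2
      have hts := sub_nonneg.2 hst
      have hV := le_mul_rpow_mul_rpow v.coe_nonneg hL.le hts (by positivity) (by positivity) hγ1
        hV1 hV2
      have hsq : L * ((t - s) ^ (2 * γ) * ((k : ℝ) ^ (-β)) ^ (1 - 2 * γ)) =
          (√L * ((t - s) ^ γ * (k : ℝ) ^ (-β * (1 - 2 * γ) / 2))) ^ 2 := by
        rw [mul_pow, mul_pow, Real.sq_sqrt hL.le, ← Real.rpow_mul_natCast hts,
          ← Real.rpow_mul_natCast hk0.le, ← Real.rpow_mul hk0.le]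
        congr 3
        · push_cast
          ring
        · push_cast
          ring
      rw [hsq] at hV
      have hsqrt := Real.sqrt_le_sqrt hV
      rw [Real.sqrt_sq (by positivity)] at hsqrt
      rw [hval, ← hκ]
      calc _ ≤ (√L * ((t - s) ^ γ * (k : ℝ) ^ (-β * (1 - 2 * γ) / 2))) ^ m * κ := by gcongr
        _ = _ := by
          rw [mul_pow]
          ring)
  refine ⟨R, hR.mono fun ω hω k hk t₁ ht₁ t₂ ht₂ => (hω k hk t₁ ht₁ t₂ ht₂).trans (le_of_eq ?_)⟩
  have hk0 : (0 : ℝ) < k := by exact_mod_cast hk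
  rw [← Real.rpow_add hk0]
  congr 2
  field_simp
  ring
end
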